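/- For every n ≥ 3 and all integers i, j with 3 ≤ i < j ≤ n, the number of permutations of [n] whose circular peak set is {i, j} is cp_n({i,j}) = 2^{n−3}·(2^{i−2} − 1)·(2^{j−i−1} − 1) + 2^{n+j−i−5}·3·(3^{i−2} − 2^{i−1} + 1). -/

import Mathlib

/-- The permutation σ of `Fin n` viewed as a word on `[n] = {1,…,n}`:
position `j` (0-indexed) carries the letter `σ(j)+1`; out-of-range positions give `0`. -/
def permToFun (n : ℕ) (σ : Equiv.Perm (Fin n)) : ℕ → ℕ :=
  fun j => if h : j < n then ((σ ⟨j, h⟩ : ℕ) + 1) else 0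

/-- The circular peak set `CP(σ) = {σ(i) | σ(i-1) < σ(i) > σ(i+1)}` of a
permutation of `[n]`, as a `Finset ℕ` of values in `{1,…,n}`. -/
def circularPeakSet (n : ℕ) (σ : Equiv.Perm (Fin n)) : Finset ℕ :=
  ((Finset.Ioo 0 (n - 1)).filter (fun j =>
    permToFun n σ (j - 1) < permToFun n σ j ∧
    permToFun n σ (j + 1) < permToFun n σ j)).image (permToFun n σ)

/-- `CPperms n S` is the set `CP_n(S)` of permutations of `[n]` with circular peak set `S`. -/
def CPperms (n : ℕ) (S : Finset ℕ) : Finset (Equiv.Perm (Fin n)) :=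
  Finset.univ.filter (fun σ => circularPeakSet n σ = S)

/-- `cp n S = |CP_n(S)|`. -/
def cp (n : ℕ) (S : Finset ℕ) : ℕ := (CPperms n S).card

open Finset

def cpIns (m : ℕ) (x : Fin (m+1) × Equiv.Perm (Fin m)) : Equiv.Perm (Fin (m+1)) :=
  (finSuccEquiv' x.1).trans ((Equiv.optionCongr x.2).trans (finSuccEquiv' (Fin.last m)).symm)

lemma cpIns_self (m : ℕ) (k : Fin (m+1)) (σ : Equiv.Perm (Fin m)) :
    cpIns m (k, σ) k = Fin.last m := by
  simp [cpIns]

lemma cpIns_succAbove (m : ℕ) (k : Fin (m+1)) (σ : Equiv.Perm (Fin m)) (i : Fin m) :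
    cpIns m (k, σ) (k.succAbove i) = (σ i).castSucc := by
  simp [cpIns]

lemma cpIns_bij (m : ℕ) : Function.Bijective (cpIns m) := by
  rw [Fintype.bijective_iff_injective_and_card]
  constructor
  · rintro ⟨k, σ⟩ ⟨l, τ⟩ h
    have hk : k = l := by
      have h1 := cpIns_self m k σ
      have h2 := cpIns_self m l τ
      rw [← h] at h2
      exact (cpIns m (k, σ)).injective (h1.trans h2.symm)
    subst hk
    congr 1
    ext i
    have h1 := cpIns_succAbove m k σ i
    have h2 := cpIns_succAbove m k τ i
    rw [← h, h1] at h2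
    simpa using congrArg Fin.val h2
  · simp [Fintype.card_perm, Nat.factorial_succ]

lemma permToFun_cpIns (m : ℕ) (k : Fin (m+1)) (σ : Equiv.Perm (Fin m)) (j : ℕ) :
    permToFun (m+1) (cpIns m (k, σ)) j =
      if j < k then permToFun m σ j else if j = k then m+1 else permToFun m σ (j-1) := by
  have hk := k.2
  by_cases hj : j < m + 1
  · rcases lt_trichotomy j k with h | h | h
    · have e : (⟨j, hj⟩ : Fin (m+1)) = k.succAbove ⟨j, by omega⟩ := by
        rw [Fin.succAbove_of_castSucc_lt]
        · rfl
        · exact h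
      have hj' : j < m := by omega
      simp [permToFun, hj, h, e, cpIns_succAbove, hj']
    · have e : (⟨j, hj⟩ : Fin (m+1)) = k := by ext; exact h
      simp only [permToFun, hj, e, cpIns_self, h]
      simp; omega
    · have hj' : j - 1 < m := by omega
      have e : (⟨j, hj⟩ : Fin (m+1)) = k.succAbove ⟨j-1, hj'⟩ := by
        rw [Fin.succAbove_of_le_castSucc]
        · ext; simp; omega
        · rw [Fin.le_def]; simp; omega
      have h1 : ¬ j < k := by omega
      have h2 : ¬ j = k := by omega
      simp [permToFun, hj, h1, h2, e, cpIns_succAbove, hj']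
  · have h1 : ¬ j < k := by omega
    have h2 : ¬ j = k := by omega
    have h3 : ¬ j - 1 < m := by omega
    simp [permToFun, hj, h1, h2, h3]

lemma ptf_pos (m : ℕ) (σ : Equiv.Perm (Fin m)) (j : ℕ) (h : j < m) :
    1 ≤ permToFun m σ j ∧ permToFun m σ j ≤ m := by
  simp only [permToFun, h, dif_pos]
  have := (σ ⟨j, h⟩).2
  omega

lemma ptf_inj (m : ℕ) (σ : Equiv.Perm (Fin m)) (i j : ℕ) (hi : i < m) (hj : j < m)
    (h : permToFun m σ i = permToFun m σ j) : i = j := by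
  simp only [permToFun, hi, hj, dif_pos] at h
  have h' : σ ⟨i, hi⟩ = σ ⟨j, hj⟩ := by ext; omega
  simpa using σ.injective h'

lemma mem_cps (n : ℕ) (σ : Equiv.Perm (Fin n)) (v : ℕ) : v ∈ circularPeakSet n σ ↔
    ∃ j, 0 < j ∧ j + 1 < n ∧ permToFun n σ (j-1) < permToFun n σ j ∧
      permToFun n σ (j+1) < permToFun n σ j ∧ permToFun n σ j = v := by
  simp only [circularPeakSet, mem_image, mem_filter, mem_Ioo]
  constructor
  · rintro ⟨j, ⟨⟨h1, h2⟩, h3, h4⟩, h5⟩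
    exact ⟨j, h1, by omega, h3, h4, h5⟩
  · rintro ⟨j, h1, h2, h3, h4, h5⟩
    exact ⟨j, ⟨⟨h1, by omega⟩, h3, h4⟩, h5⟩

/-- inserting at an end does not change the peak set -/
lemma cps_end (m : ℕ) (k : Fin (m+1)) (σ : Equiv.Perm (Fin m)) (hk : (k:ℕ) = 0 ∨ (k:ℕ) = m) :
    circularPeakSet (m+1) (cpIns m (k, σ)) = circularPeakSet m σ := by
  ext v
  rw [mem_cps, mem_cps]
  have hb := ptf_pos m σ
  simp only [permToFun_cpIns]
  generalize (k:ℕ) = q at *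
  generalize permToFun m σ = w at *
  rcases hk with rfl | rfl
  · constructor
    · rintro ⟨j, h1, h2, h3, h4, h5⟩
      have := hb (j-1) (by omega)
      have hj : j ≠ 1 := by
        rintro rfl
        simp at h3 this
        omega
      refine ⟨j-1, by omega, by omega, ?_⟩
      have e : j - 1 + 1 = j := by omega
      have e2 : ¬ (j - 1 = 0) := by omega
      have e3 : ¬ (j = 0) := by omega
      simp [e2, e3] at h3 h4 h5
      rw [e]
      exact ⟨h3, h4, h5⟩
    · rintro ⟨j, h1, h2, h3, h4, h5⟩
      refine ⟨j+1, by omega, by omega, ?_⟩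
      have e3 : ¬ (j = 0) := by omega
      simp [e3]
      exact ⟨h3, h4, h5⟩
  · constructor
    · rintro ⟨j, h1, h2, h3, h4, h5⟩
      have hj : j + 1 ≠ q := by
        rintro rfl
        have := hb j (by omega)
        simp at h4
        omega
      refine ⟨j, by omega, by omega, ?_⟩
      have e1 : j - 1 < q := by omega
      have e2 : j < q := by omega
      have e3 : j + 1 < q := by omega
      simp only [e1, e2, e3, if_true] at h3 h4 h5
      exact ⟨h3, h4, h5⟩
    · rintro ⟨j, h1, h2, h3, h4, h5⟩
      refine ⟨j, by omega, by omega, ?_⟩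
      have e1 : j - 1 < q := by omega
      have e2 : j < q := by omega
      have e3 : j + 1 < q := by omega
      simp only [e1, e2, e3, if_true]
      exact ⟨h3, h4, h5⟩

/-- inserting in the interior -/
lemma cps_mid (m : ℕ) (k : Fin (m+1)) (σ : Equiv.Perm (Fin m)) (hk : 0 < (k:ℕ)) (hk' : (k:ℕ) < m) :
    circularPeakSet (m+1) (cpIns m (k, σ)) =
      insert (m+1) (circularPeakSet m σ \ {permToFun m σ (k-1), permToFun m σ k}) := by
  ext v
  simp only [mem_insert, mem_sdiff, mem_singleton]
  rw [mem_cps, mem_cps]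
  have hb := ptf_pos m σ
  have hinj := ptf_inj m σ
  simp only [permToFun_cpIns]
  generalize (k:ℕ) = q at *
  generalize permToFun m σ = w at *
  constructor
  · rintro ⟨j, h1, h2, h3, h4, h5⟩
    rcases lt_trichotomy j q with h | h | h
    · right
      have hj : j + 1 ≠ q := by
        rintro rfl
        have := hb j (by omega)
        simp at h4
        omega
      have e1 : j - 1 < q := by omega
      have e3 : j + 1 < q := by omega
      simp only [e1, h, e3, if_true] at h3 h4 h5
      refine ⟨⟨j, by omega, by omega, h3, h4, h5⟩, ?_⟩
      rintro (h6 | h6)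
      · have := hinj j (q-1) (by omega) (by omega) (h5.trans h6); omega
      · have := hinj j q (by omega) (by omega) (h5.trans h6); omega
    · left
      simpa [h] using h5.symm
    · right
      have hj : j ≠ q + 1 := by
        rintro rfl
        have := hb q (by omega)
        simp at h3
        omega
      have e1 : ¬ j - 1 < q := by omega
      have e2 : ¬ j < q := by omega
      have e3 : ¬ j + 1 < q := by omega
      have f1 : ¬ j - 1 = q := by omega
      have f2 : ¬ j = q := by omega
      have f3 : ¬ j + 1 = q := by omega
      simp only [e1, e2, e3, f1, f2, f3, if_false] at h3 h4 h5
      refine ⟨⟨j-1, by omega, by omega, h3, ?_, h5⟩, ?_⟩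
      · have e : j - 1 + 1 = j + 1 - 1 := by omega
        rw [e]; exact h4
      rintro (h6 | h6)
      · have := hinj (j-1) (q-1) (by omega) (by omega) (h5.trans h6); omega
      · have := hinj (j-1) q (by omega) (by omega) (h5.trans h6); omega
  · rintro (h | ⟨⟨j, h1, h2, h3, h4, h5⟩, h6⟩)
    · refine ⟨q, hk, by omega, ?_⟩
      have := hb q hk'
      have := hb (q-1) (by omega)
      have e1 : q - 1 < q := by omega
      simp [e1, h]
      omega
    · push Not at h6
      have n1 : j ≠ q - 1 := by rintro rfl; exact h6.1 h5.symm
      have n2 : j ≠ q := by rintro rfl; exact h6.2 h5.symm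
      rcases lt_or_ge j q with h | h
      · refine ⟨j, by omega, by omega, ?_⟩
        have e1 : j - 1 < q := by omega
        have e3 : j + 1 < q := by omega
        simp only [e1, h, e3, if_true]
        exact ⟨h3, h4, h5⟩
      · refine ⟨j+1, by omega, by omega, ?_⟩
        have e1 : ¬ j + 1 - 1 < q := by omega
        have e2 : ¬ j + 1 < q := by omega
        have e3 : ¬ j + 1 + 1 < q := by omega
        have f1 : ¬ j + 1 - 1 = q := by omega
        have f2 : ¬ j + 1 = q := by omega
        have f3 : ¬ j + 1 + 1 = q := by omega
        simp only [e1, e2, e3, f1, f2, f3, if_false]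
        exact ⟨h3, h4, h5⟩

/-- per-permutation counting -/
lemma cp_succ_sum (m : ℕ) (S : Finset ℕ) : (cp (m+1) S : ℤ) =
    ∑ σ : Equiv.Perm (Fin m), ∑ k : Fin (m+1),
      if circularPeakSet (m+1) (cpIns m (k, σ)) = S then 1 else 0 := by
  rw [sum_comm, ← Fintype.sum_prod_type', cp, CPperms, card_filter]
  push_cast
  exact (Function.Bijective.sum_comp (cpIns_bij m)
    (fun τ => if circularPeakSet (m+1) τ = S then (1:ℤ) else 0)).symm

lemma cp_eq_sum (m : ℕ) (S : Finset ℕ) : (cp m S : ℤ) =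
    ∑ σ : Equiv.Perm (Fin m), if circularPeakSet m σ = S then 1 else 0 := by
  rw [cp, CPperms, card_filter]
  push_cast
  rfl

lemma cps_sub (m : ℕ) (σ : Equiv.Perm (Fin m)) : circularPeakSet m σ ⊆ Icc 1 m := by
  intro v hv
  rw [mem_cps] at hv
  obtain ⟨j, h1, h2, h3, h4, h5⟩ := hv
  rw [mem_Icc, ← h5]
  exact ptf_pos m σ j (by omega)

lemma sum_split (m : ℕ) (hm : 1 ≤ m) (f : ℕ → ℤ) :
    ∑ k : Fin (m+1), f k = f 0 + f m + ∑ k ∈ Ioo 0 m, f k := by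
  rw [Fin.sum_univ_eq_sum_range (fun k => f k) (m+1), sum_range_succ]
  have : range m = insert 0 (Ioo 0 m) := by
    ext x; simp; omega
  rw [this, sum_insert (by simp)]
  ring

def cpIndic (m : ℕ) (σ : Equiv.Perm (Fin m)) (S : Finset ℕ) (k : ℕ) : ℤ :=
  if k = 0 ∨ k = m then (if circularPeakSet m σ = S then 1 else 0)
  else if insert (m+1) (circularPeakSet m σ \ {permToFun m σ (k-1), permToFun m σ k}) = S
    then 1 else 0

lemma cp_succ_sum' (m : ℕ) (hm : 1 ≤ m) (S : Finset ℕ) : (cp (m+1) S : ℤ) =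
    ∑ σ : Equiv.Perm (Fin m), (2 * (if circularPeakSet m σ = S then 1 else 0) +
      ∑ k ∈ Ioo 0 m, if insert (m+1) (circularPeakSet m σ \ {permToFun m σ (k-1), permToFun m σ k}) = S
        then 1 else 0) := by
  rw [cp_succ_sum]
  refine sum_congr rfl fun σ _ => ?_
  have : ∀ k : Fin (m+1), (if circularPeakSet (m+1) (cpIns m (k, σ)) = S then (1:ℤ) else 0)
      = cpIndic m σ S k := by
    intro k
    rw [cpIndic]
    by_cases h : (k:ℕ) = 0 ∨ (k:ℕ) = m
    · rw [if_pos h, cps_end m k σ h]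
    · rw [if_neg h, cps_mid m k σ (by omega) (by omega)]
  rw [sum_congr rfl (fun k _ => this k), sum_split m hm (cpIndic m σ S)]
  congr 1
  · simp only [cpIndic, true_or, or_true, if_true]; ring
  · refine sum_congr rfl fun k hk => ?_
    rw [mem_Ioo] at hk
    rw [cpIndic, if_neg (by omega)]

lemma cp_notMem (m : ℕ) (hm : 1 ≤ m) (S : Finset ℕ) (hS : m + 1 ∉ S) :
    (cp (m+1) S : ℤ) = 2 * cp m S := by
  rw [cp_succ_sum' m hm, cp_eq_sum, mul_sum]
  refine sum_congr rfl fun σ _ => ?_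
  rw [add_eq_left]
  refine sum_eq_zero fun k _ => if_neg ?_
  rintro rfl
  exact hS (mem_insert_self _ _)

/-- key count -/
lemma key_count (m : ℕ) (hm : 1 ≤ m) (S : Finset ℕ) (σ : Equiv.Perm (Fin m)) :
    (∑ k ∈ Ioo 0 m, if circularPeakSet m σ \ {permToFun m σ (k-1), permToFun m σ k} = S
        then (1:ℤ) else 0) =
    ((m:ℤ) - 1 - 2 * #S) * (if circularPeakSet m σ = S then 1 else 0) +
      2 * ∑ p ∈ Icc 1 m \ S, if circularPeakSet m σ = insert p S then 1 else 0 := by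
  have hsub := cps_sub m σ
  set w := permToFun m σ with hw
  set C := circularPeakSet m σ with hC
  set P := (Finset.Ioo 0 (m - 1)).filter (fun j => w (j - 1) < w j ∧ w (j + 1) < w j) with hP
  have hCP : C = P.image w := rfl
  have hinj := ptf_inj m σ
  rw [← hw] at hinj
  have hPm : ∀ j, j ∈ P → 0 < j ∧ j + 1 < m ∧ w (j-1) < w j ∧ w (j+1) < w j := by
    intro j hj
    simp only [hP, mem_filter, mem_Ioo] at hj
    exact ⟨hj.1.1, by omega, hj.2⟩
  have hwC : ∀ j, j < m → (w j ∈ C ↔ j ∈ P) := by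
    intro j hj
    rw [hCP, mem_image]
    constructor
    · rintro ⟨t, ht, e⟩
      have := hPm t ht
      have := hinj t j (by omega) hj e
      exact this ▸ ht
    · intro h; exact ⟨j, h, rfl⟩
  have hadj : ∀ j, j ∈ P → j + 1 ∉ P := by
    intro j hj h
    have h1 := hPm _ hj
    have h2 := hPm _ h
    simp at h2
    omega
  by_cases h : C = S
  · have h0 : ∀ p ∈ Icc 1 m \ S, (if C = insert p S then (1:ℤ) else 0) = 0 := by
      intro p hp
      rw [if_neg]
      intro e
      rw [h] at e
      rw [mem_sdiff] at hp
      apply hp.2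
      rw [e]; exact mem_insert_self _ _
    rw [sum_eq_zero h0, if_pos h]
    have hcard : #S = #P := by
      rw [← h, hCP, card_image_of_injOn]
      intro x hx y hy hxy
      have h1 := hPm x hx
      have h2 := hPm y hy
      exact hinj x y (by omega) (by omega) hxy
    have ht : ∀ k ∈ Ioo 0 m, (if C \ {w (k-1), w k} = S then (1:ℤ) else 0) =
        1 - (if k ∈ P then 1 else 0) - (if k ∈ P.image (· + 1) then 1 else 0) := by
      intro k hk
      rw [mem_Ioo] at hk
      have a1 := hwC k hk.2
      have a2 := hwC (k-1) (by omega)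
      have a3 : k ∈ P.image (· + 1) ↔ k - 1 ∈ P := by
        rw [mem_image]
        constructor
        · rintro ⟨x, hx, rfl⟩; simpa using hx
        · intro hx; exact ⟨k-1, hx, by omega⟩
      have a4 := hadj (k-1)
      rw [Nat.sub_add_cancel hk.1] at a4
      have a5 : C \ {w (k-1), w k} = S ↔ (k - 1 ∉ P ∧ k ∉ P) := by
        rw [← h, Finset.sdiff_eq_self_iff_disjoint, disjoint_insert_right, disjoint_singleton_right, a1, a2]
      simp only [a3, a5]
      by_cases b1 : k ∈ P <;> by_cases b2 : k - 1 ∈ P <;> simp [b1, b2]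
      exact a4 b2 b1
    rw [sum_congr rfl ht, sum_sub_distrib, sum_sub_distrib, ← sum_filter, ← sum_filter]
    have e1 : (Ioo 0 m).filter (fun k => k ∈ P) = P := by
      ext x
      simp only [mem_filter, mem_Ioo]
      constructor
      · exact fun h => h.2
      · intro hx
        have := hPm x hx
        exact ⟨by omega, hx⟩
    have e2 : (Ioo 0 m).filter (fun k => k ∈ P.image (· + 1)) = P.image (· + 1) := by
      ext x
      simp only [mem_filter, mem_Ioo]
      constructor
      · exact fun h => h.2
      · intro hx
        refine ⟨?_, hx⟩
        obtain ⟨y, hy, rfl⟩ := mem_image.1 hx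
        have := hPm y hy
        constructor <;> omega
    rw [e1, e2]
    simp only [sum_const, Nat.card_Ioo]
    rw [card_image_of_injective _ (add_left_injective 1), hcard]
    simp
    have : ((m - 1 : ℕ) : ℤ) = m - 1 := by omega
    rw [this]; ring
  · rw [if_neg h]
    by_cases h' : ∃ p ∈ Icc 1 m \ S, C = insert p S
    · obtain ⟨p, hp, e⟩ := h'
      have hpS := (mem_sdiff.1 hp).2
      rw [sum_eq_single_of_mem p hp]
      · rw [if_pos e]
        have hpC : p ∈ C := by rw [e]; exact mem_insert_self _ _
        obtain ⟨t, ht, rfl⟩ := mem_image.1 (hCP ▸ hpC)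
        have htt := hPm t ht
        have : ∀ k ∈ Ioo 0 m, (if C \ {w (k-1), w k} = S then (1:ℤ) else 0) =
            if k ∈ ({t, t+1} : Finset ℕ) then 1 else 0 := by
          intro k hk
          rw [mem_Ioo] at hk
          congr 1
          rw [eq_iff_iff, mem_insert, mem_singleton]
          constructor
          · intro e3
            by_contra hne
            push Not at hne
            apply hpS
            rw [← e3, mem_sdiff, mem_insert, mem_singleton]
            refine ⟨hpC, ?_⟩
            rintro (h6 | h6)
            · have := hinj t (k-1) (by omega) (by omega) h6; omega
            · have := hinj t k (by omega) (by omega) h6; omega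
          · rintro (rfl | rfl)
            · have b1 : w (k-1) ∉ C := by
                rw [hwC _ (by omega)]
                intro h7
                have := hadj _ h7
                rw [Nat.sub_add_cancel hk.1] at this
                exact this ht
              rw [sdiff_insert, sdiff_singleton_eq_erase, e, erase_insert hpS,
                erase_eq_of_notMem]
              intro h8; exact b1 (e ▸ mem_insert_of_mem h8)
            · have b1 : w (t+1) ∉ C := by
                rw [hwC _ (by omega)]
                exact hadj _ ht
              rw [Nat.add_sub_cancel, pair_comm, sdiff_insert, sdiff_singleton_eq_erase, e,
                erase_insert hpS, erase_eq_of_notMem]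
              intro h8; exact b1 (e ▸ mem_insert_of_mem h8)
        rw [sum_congr rfl this, ← sum_filter]
        have e2 : (Ioo 0 m).filter (fun k => k ∈ ({t, t+1} : Finset ℕ)) = {t, t+1} := by
          ext x; simp; omega
        rw [e2]; simp
      · intro q hq hqp
        rw [if_neg]
        intro e'
        have : q ∈ insert p S := by rw [← e, e']; exact mem_insert_self _ _
        rw [mem_insert] at this
        exact this.elim hqp (mem_sdiff.1 hq).2
    · push Not at h'
      rw [sum_eq_zero (s := Icc 1 m \ S) (fun p hp => if_neg (h' p hp))]
      simp only [mul_zero, add_zero]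
      refine sum_eq_zero fun k hk => if_neg ?_
      intro e
      rw [mem_Ioo] at hk
      have b0 := hwC k hk.2
      have b1 := hwC (k-1) (by omega)
      have b2 := hadj (k-1)
      rw [Nat.sub_add_cancel hk.1] at b2
      by_cases c1 : w (k-1) ∈ C
      · have c2 : w k ∉ C := fun h => b2 (b1.1 c1) (b0.1 h)
        refine h' (w (k-1)) (mem_sdiff.2 ⟨hsub c1, ?_⟩) ?_
        · rw [← e]; simp
        · rw [← e]; ext x; simp only [mem_insert, mem_sdiff, mem_singleton]; grind
      · by_cases c2 : w k ∈ C
        · refine h' (w k) (mem_sdiff.2 ⟨hsub c2, ?_⟩) ?_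
          · rw [← e]; simp
          · rw [← e]; ext x; simp only [mem_insert, mem_sdiff, mem_singleton]; grind
        · apply h
          rw [← e, eq_comm, Finset.sdiff_eq_self_iff_disjoint, disjoint_insert_right, disjoint_singleton_right]
          exact ⟨c1, c2⟩

lemma cp_mem (m : ℕ) (hm : 1 ≤ m) (S : Finset ℕ) (hS : m + 1 ∉ S) :
    (cp (m+1) (insert (m+1) S) : ℤ) = ((m:ℤ) - 1 - 2 * #S) * cp m S +
      2 * ∑ p ∈ Icc 1 m \ S, (cp m (insert p S) : ℤ) := by
  rw [cp_succ_sum' m hm]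
  simp only [cp_eq_sum m]
  rw [sum_comm, mul_sum, mul_sum, ← sum_add_distrib]
  refine sum_congr rfl fun σ _ => ?_
  rw [← key_count m hm S σ]
  have hm1 : m + 1 ∉ circularPeakSet m σ := by
    intro h
    have := cps_sub m σ h
    rw [mem_Icc] at this
    omega
  rw [if_neg, mul_zero, zero_add]
  · refine sum_congr rfl fun k _ => ?_
    congr 1
    rw [eq_iff_iff]
    constructor
    · intro h
      rw [← erase_insert hS, ← h, erase_insert]
      intro h'; exact hm1 (mem_sdiff.1 h').1
    · intro h; rw [h]
  · intro h
    apply hm1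
    rw [h]; exact mem_insert_self _ _

lemma cp_one_mem (m : ℕ) (S : Finset ℕ) (h : 1 ∈ S) : (cp m S : ℤ) = 0 := by
  rw [cp_eq_sum]
  refine sum_eq_zero fun σ _ => if_neg ?_
  rintro rfl
  obtain ⟨j, h1, h2, h3, h4, h5⟩ := (mem_cps _ _ _).1 h
  have := ptf_pos m σ (j-1) (by omega)
  omega

lemma cp_empty (m : ℕ) : (cp (m+1) ∅ : ℤ) = 2 ^ m := by
  induction m with
  | zero => 
    have : cp 1 ∅ = 1 := by decide
    simp [this]
  | succ m ih =>
    rw [cp_notMem (m+1) (by omega) ∅ (by simp), ih, pow_succ]; ring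

lemma sum_pow_two (k : ℕ) : ∑ x ∈ range k, ((2:ℤ)^x - 1) = 2^k - 1 - k := by
  induction k with
  | zero => simp
  | succ k ih => rw [sum_range_succ, ih, pow_succ]; push_cast; ring

lemma sum_Icc_one (m : ℕ) (f : ℕ → ℤ) :
    ∑ p ∈ Icc 1 (m+1), f p = f 1 + ∑ x ∈ range m, f (x + 2) := by
  have : Icc 1 (m+1) = (range (m+1)).image (· + 1) := by
    ext x; simp only [mem_Icc, mem_image, mem_range]
    constructor
    · intro h; exact ⟨x-1, by omega, by omega⟩
    · rintro ⟨y, hy, rfl⟩; omega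
  rw [this, sum_image (by intro x _ y _; simp), sum_range_succ', add_comm]

lemma cp_single (n : ℕ) : ∀ a, a ≤ n → (cp (n+2) {a+2} : ℤ) = 2^n * (2^a - 1) := by
  induction n with
  | zero =>
    intro a ha
    obtain rfl : a = 0 := by omega
    have : cp 2 {2} = 0 := by decide
    simp [this]
  | succ n ih =>
    intro a ha
    rcases Nat.lt_or_ge n a with h | h
    · obtain rfl : a = n + 1 := by omega
      have := cp_mem (n+2) (by omega) ∅ (by simp)
      simp only [insert_empty_eq, sdiff_empty] at this
      rw [show n + 1 + 2 = n + 2 + 1 by ring, this, sum_Icc_one, cp_one_mem _ {1} (by simp),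
        show n + 2 = n + 1 + 1 by ring, cp_empty]
      rw [sum_congr rfl (fun x hx => ih x (by rw [mem_range] at hx; omega)), ← mul_sum, sum_pow_two]
      push_cast
      simp
      ring
    · rw [show n + 1 + 2 = n + 2 + 1 by ring, cp_notMem _ (by omega) _ (by simp; omega), ih a h]
      ring

def cpG (a d : ℕ) : ℤ := 2 * (2^a-1) * (2^d-1) + 3 * 2^d * (3^a - 2 * 2^a + 1)

lemma sum_G1 (a d : ℕ) : ∑ x ∈ range d, cpG a x =
    2 * (2^a-1) * (2^d-1-d) + 3 * (2^d-1) * (3^a - 2 * 2^a + 1) := by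
  induction d with
  | zero => simp
  | succ d ih => rw [sum_range_succ, ih, cpG]; push_cast; ring

lemma sum_G2 (a : ℕ) : ∑ x ∈ range a, cpG x (a-1-x) =
    3 * (3^a - 2 * 2^a + 1) - 2 * (a-1) * (2^a-1) := by
  induction a with
  | zero => simp
  | succ a ih =>
    have : ∀ x ∈ range a, cpG x (a+1-1-x) = 2 * cpG x (a-1-x) + 2 * (2^x-1) := by
      intro x hx
      rw [mem_range] at hx
      rw [show a + 1 - 1 - x = a - 1 - x + 1 by omega, cpG, cpG]
      ring
    rw [sum_range_succ, sum_congr rfl this, sum_add_distrib, ← mul_sum, ← mul_sum, ih, sum_pow_two]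
    simp [cpG]
    ring

lemma cp_two (n : ℕ) : ∀ a d, a + d ≤ n → 2 * (cp (n+3) {a+2, a+d+3} : ℤ) = 2^n * cpG a d := by
  induction n with
  | zero =>
    intro a d h
    obtain rfl : a = 0 := by omega
    obtain rfl : d = 0 := by omega
    have := cp_mem 2 (by omega) {2} (by simp)
    rw [show Icc 1 2 \ {2} = ({1} : Finset ℕ) by decide, sum_singleton, cp_one_mem 2 {1, 2} (by simp)] at this
    have h2 : cp 2 {2} = 0 := by decide
    rw [h2, pair_comm] at this
    simp at this
    simp [cpG, this]
  | succ n ih =>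
    intro a d h
    rcases Nat.lt_or_ge n (a+d) with h1 | h1
    · have hn : n + 1 = a + d := by omega
      have := cp_mem (n+3) (by omega) {a+2} (by simp; omega)
      rw [pair_comm, show n + 1 + 3 = n + 3 + 1 by ring, show a + d + 3 = n + 3 + 1 by omega, this,
        card_singleton, cp_single (n+1) a (by omega)]
      have hs : ∑ p ∈ Icc 1 (n+3) \ {a+2}, (cp (n+3) {p, a+2} : ℤ) =
          ∑ x ∈ range a, (cp (n+3) {x+2, a+2} : ℤ) + ∑ x ∈ range d, (cp (n+3) {a+2, a+x+3} : ℤ) := by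
        have := sum_sdiff (s₁ := {a+2}) (s₂ := Icc 1 (n+3)) (f := fun p => (cp (n+3) {p, a+2} : ℤ))
          (by simp; omega)
        rw [sum_singleton, sum_Icc_one, cp_one_mem _ {1, a+2} (by simp),
          show n + 2 = a + (d + 1) by omega, sum_range_add, sum_range_succ'] at this
        simp only [add_zero] at this
        have e : ∀ x, (cp (n+3) {a + (x+1) + 2, a+2} : ℤ) = cp (n+3) {a+2, a+x+3} := by
          intro x
          rw [pair_comm, show a + (x+1) + 2 = a + x + 3 by ring]
        simp only [e] at this
        linarith
      have hA : 2 * ∑ x ∈ range a, (cp (n+3) {x+2, a+2} : ℤ) = 2^n * ∑ x ∈ range a, cpG x (a-1-x) := by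
        rw [mul_sum, mul_sum]
        refine sum_congr rfl fun x hx => ?_
        rw [mem_range] at hx
        rw [← ih x (a-1-x) (by omega), show x + (a-1-x) + 3 = a + 2 by omega]
      have hD : 2 * ∑ x ∈ range d, (cp (n+3) {a+2, a+x+3} : ℤ) = 2^n * ∑ x ∈ range d, cpG a x := by
        rw [mul_sum, mul_sum]
        refine sum_congr rfl fun x hx => ?_
        rw [mem_range] at hx
        rw [← ih a x (by omega)]
      rw [sum_G2] at hA
      rw [sum_G1] at hD
      rw [hs]
      have hn' : (n:ℤ) = a + d - 1 := by omega
      rw [cpG]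
      push_cast
      rw [hn']
      linear_combination 2 * hA + 2 * hD
    · rw [show n + 1 + 3 = n + 3 + 1 by ring, cp_notMem _ (by omega) _ (by simp; omega)]
      linear_combination 2 * ih a d h1

/-- Theorem 2.1(3): for `n ≥ 3` and `3 ≤ i < j ≤ n`,
`cp_n({i,j}) = 2^{n-3}(2^{i-2}-1)(2^{j-i-1}-1) + 2^{n+j-i-5}·3·(3^{i-2}-2^{i-1}+1)`. -/
theorem cp_pair (n i j : ℕ) (hn : 3 ≤ n) (hi : 3 ≤ i) (hij : i < j) (hjn : j ≤ n) :
    (cp n ({i, j} : Finset ℕ) : ℤ) =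
      2 ^ (n - 3) * (2 ^ (i - 2) - 1) * (2 ^ (j - i - 1) - 1) +
      2 ^ (n + j - i - 5) * 3 * (3 ^ (i - 2) - 2 ^ (i - 1) + 1) := by
  obtain ⟨a, rfl⟩ : ∃ a, i = a + 2 + 1 := ⟨i - 3, by omega⟩
  obtain ⟨d, rfl⟩ : ∃ d, j = (a + 1) + d + 3 := ⟨j - (a + 4), by omega⟩
  obtain ⟨e, rfl⟩ : ∃ e, n = a + 1 + d + e + 3 := ⟨n - (a + d + 4), by omega⟩
  have := cp_two (a + 1 + d + e) (a + 1) d (by omega)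
  rw [show a + 1 + 2 = a + 2 + 1 by ring] at this
  rw [show a + 1 + d + e + 3 - 3 = a + d + e + 1 by omega, show a + 2 + 1 - 2 = a + 1 by omega,
    show a + 1 + d + 3 - (a + 2 + 1) - 1 = d by omega,
    show a + 1 + d + e + 3 + (a + 1 + d + 3) - (a + 2 + 1) - 5 = a + d + e + d by omega,
    show a + 2 + 1 - 1 = a + 2 by omega]
  rw [cpG] at this
  have h2 : (2:ℤ) ≠ 0 := by norm_num
  apply mul_left_cancel₀ h2
  rw [this]
  ring
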